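/- Let C be a category and let π : E ⥤ C be a precompact expansion, where E is small, locally finite, confluent and has the Ramsey property. Then π has a core: there exists an expansion ρ : F ⥤ C that is a core, together with homomorphisms of expansions α : F ⥤ E (π ∘ α = ρ) and β : E ⥤ F (ρ ∘ β = π). -/

import Mathlib

open CategoryTheory Opposite

universe v u v' u'

/-- A category is confluent if any two objects connected by a zigzag admit a cocone. -/
def Confluent (C : Type u) [Category.{v} C] : Prop :=
  ∀ A B : C, Zigzag A B → ∃ (Z : C) (_ : A ⟶ Z) (_ : B ⟶ Z), True

/-- The Ramsey property of a category. -/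
def RamseyProp (C : Type u) [Category.{v} C] : Prop :=
  ∀ (A B : C) (N : Type) (_ : Finite N), ∃ Z : C,
    ∀ χ : (A ⟶ Z) → N, ∃ g : B ⟶ Z,
      ∀ f f' : A ⟶ B, χ (f ≫ g) = χ (f' ≫ g)

/-- An (abstract) expansion: a functor that is surjective on objects and a
discrete fibration. -/
structure IsExpansion {E : Type u} {C : Type u'} [Category.{v} E] [Category.{v'} C]
    (π : E ⥤ C) : Prop where
  surj : ∀ c : C, ∃ e : E, π.obj e = c
  fib : ∀ (e : E) (c : C) (f : c ⟶ π.obj e),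
    ∃! p : Σ e' : E, e' ⟶ e, ∃ h : π.obj p.1 = c, π.map p.2 = eqToHom h ≫ f

/-- An expansion is precompact if all of its fibers on objects are finite. -/
def Precompact {E : Type u} {C : Type u'} [Category.{v} E] [Category.{v'} C]
    (π : E ⥤ C) : Prop :=
  ∀ c : C, {e : E | π.obj e = c}.Finite

/-- An expansion is a core if all of its endomorphisms are bijective on objects. -/
def IsCore {E : Type u} {C : Type u'} [Category.{v} E] [Category.{v'} C]
    (π : E ⥤ C) : Prop :=
  ∀ α : E ⥤ E, α ⋙ π = π → Function.Bijective α.obj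

/-- A compact right topological semigroup contains an idempotent lying in a minimal left ideal. -/
theorem exists_idempotent_mem_minimal_leftIdeal {M : Type*} [Semigroup M] [TopologicalSpace M]
    [CompactSpace M] [T2Space M] [Nonempty M] (hcont : ∀ r : M, Continuous (· * r)) :
    ∃ e : M, e * e = e ∧ ∀ s : M, ∃ t : M, t * (s * e) = e := by
  let S : Set (Set M) := {N | IsClosed N ∧ N.Nonempty ∧ ∀ m, ∀ x ∈ N, m * x ∈ N}
  obtain ⟨L, -, hL⟩ : ∃ L, L ⊆ Set.univ ∧ Minimal (· ∈ S) L := by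
    refine zorn_superset_nonempty S (fun c hcS hc hne => ?_) Set.univ
      ⟨isClosed_univ, Set.univ_nonempty, fun _ _ _ => trivial⟩
    have : Nonempty c := hne.coe_sort
    refine ⟨⋂₀ c, ⟨isClosed_sInter fun t ht => (hcS ht).1, ?_, fun m x hx t ht =>
      (hcS ht).2.2 m x (hx t ht)⟩, fun s hs => Set.sInter_subset_of_mem hs⟩
    exact IsCompact.nonempty_sInter_of_directed_nonempty_isCompact_isClosed
      (IsChain.directedOn hc.symm) (fun U hU => (hcS hU).2.1)
      (fun U hU => (hcS hU).1.isCompact) (fun U hU => (hcS hU).1)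
  obtain ⟨hclosed, hne, hideal⟩ := hL.prop
  obtain ⟨e, heL, he⟩ := exists_idempotent_in_compact_subsemigroup hcont L hne hclosed.isCompact
    (fun x _ y hy => hideal x y hy)
  refine ⟨e, he, fun s => ?_⟩
  have hrange : Set.range (· * (s * e)) = L := by
    apply hL.eq_of_subset
    · refine ⟨(isCompact_range (hcont _)).isClosed, ⟨_, s, rfl⟩, ?_⟩
      rintro m _ ⟨t, rfl⟩
      exact ⟨m * t, mul_assoc _ _ _⟩
    · rintro _ ⟨t, rfl⟩
      exact hideal _ _ (hideal _ _ heL)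
  rwa [← hrange] at heL

namespace IsExpansion

variable {E : Type*} {C : Type*} [Category* E] [Category* C] {π : E ⥤ C}

theorem exists_lift (hπ : IsExpansion π) {e : E} {c : C} (f : c ⟶ π.obj e) :
    ∃ (e' : E) (g : e' ⟶ e), π.obj e' = c ∧ π.map g ≍ f := by
  obtain ⟨⟨e', g⟩, ⟨h, hg⟩, -⟩ := hπ.fib e c f
  subst h
  exact ⟨e', g, rfl, by simpa using hg⟩

theorem lift_unique (hπ : IsExpansion π) {e e₁ e₂ : E} (g₁ : e₁ ⟶ e) (g₂ : e₂ ⟶ e)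
    (h : π.obj e₁ = π.obj e₂) (hg : π.map g₁ ≍ π.map g₂) :
    (⟨e₁, g₁⟩ : Σ e' : E, e' ⟶ e) = ⟨e₂, g₂⟩ := by
  refine (hπ.fib e _ (π.map g₂)).unique ⟨h, ?_⟩ ⟨rfl, by simp⟩
  rw [← heq_iff_eq]
  exact hg.trans (eqToHom_comp_heq _ _).symm

theorem map_injective (hπ : IsExpansion π) {e' e : E} {g₁ g₂ : e' ⟶ e}
    (hg : π.map g₁ ≍ π.map g₂) : g₁ = g₂ := by
  simpa using hπ.lift_unique g₁ g₂ rfl hg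

end IsExpansion

/-- The condition on `a : E → E` to be the object map of an endomorphism of the expansion `π`. -/
structure IsEndo {E : Type*} {C : Type*} [Category* E] [Category* C] (π : E ⥤ C)
    (a : E → E) : Prop where
  obj : ∀ e, π.obj (a e) = π.obj e
  map : ∀ (e' e : E) (g : e' ⟶ e), ∃ g' : a e' ⟶ a e, π.map g' ≍ π.map g

namespace IsEndo

variable {E : Type*} {C : Type*} [Category* E] [Category* C] {π : E ⥤ C} {a b : E → E}

theorem of_functor (α : E ⥤ E) (h : α ⋙ π = π) : IsEndo π α.obj where
  obj e := Functor.congr_obj h e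
  map _ _ g := ⟨α.map g, Functor.hcongr_hom h g⟩

theorem id (π : E ⥤ C) : IsEndo π (fun e => e) where
  obj _ := rfl
  map _ _ g := ⟨g, HEq.rfl⟩

theorem comp (ha : IsEndo π a) (hb : IsEndo π b) : IsEndo π (a ∘ b) where
  obj e := (ha.obj _).trans (hb.obj _)
  map e' e g := by
    obtain ⟨g', hg'⟩ := hb.map e' e g
    obtain ⟨g'', hg''⟩ := ha.map _ _ g'
    exact ⟨g'', hg''.trans hg'⟩

theorem map_comp_heq (ha : IsEndo π a) {x y z : E} {g : x ⟶ y} {k : y ⟶ z}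
    {g' : a x ⟶ a y} {k' : a y ⟶ a z} (hg : π.map g' ≍ π.map g) (hk : π.map k' ≍ π.map k) :
    π.map (g' ≫ k') ≍ π.map (g ≫ k) := by
  have hx := ha.obj x
  have hy := ha.obj y
  have hz := ha.obj z
  simp only [Functor.map_comp]
  congr 1

theorem map_id_heq (ha : IsEndo π a) (x : E) : π.map (𝟙 (a x)) ≍ π.map (𝟙 x) := by
  rw [π.map_id, π.map_id, ha.obj x]

/-- The subcategory of fixed points of `a`. -/
@[reducible]
def fixedCategory (a : E → E) : Category {e : E // a e = e} where
  Hom x y := x.1 ⟶ y.1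
  id x := 𝟙 x.1
  comp f g := f ≫ g

/-- The endomorphisms of `π`, as a submonoid of the self-maps of the objects. -/
def submonoid (π : E ⥤ C) : Submonoid (Function.End E) where
  carrier := {a | IsEndo π a}
  mul_mem' ha hb := ha.comp hb
  one_mem' := IsEndo.id π

/-- An idempotent endomorphism lying in a minimal left ideal of the endomorphism monoid. -/
theorem exists_minimal_idempotent (hpre : Precompact π) :
    ∃ a, IsEndo π a ∧ a ∘ a = a ∧ ∀ x, IsEndo π x → ∃ y, IsEndo π y ∧ y ∘ x ∘ a = a := by
  let : TopologicalSpace E := ⊥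
  have : DiscreteTopology E := ⟨rfl⟩
  let : TopologicalSpace (Function.End E) := inferInstanceAs (TopologicalSpace (E → E))
  have : T2Space (Function.End E) := inferInstanceAs (T2Space (E → E))
  have hcont (e : E) : Continuous fun a : Function.End E => a e :=
    continuous_apply (A := fun _ => E) e
  have hclosed : IsClosed {a : Function.End E | IsEndo π a} := by
    have heq : {a : Function.End E | IsEndo π a} =
        (⋂ e, {a | π.obj (a e) = π.obj e}) ∩ ⋂ (e') (e) (g : e' ⟶ e),
          {a | ∃ g' : a e' ⟶ a e, π.map g' ≍ π.map g} := by
      ext a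
      simp only [Set.mem_inter_iff, Set.mem_iInter]
      exact ⟨fun h => ⟨h.1, h.2⟩, fun h => ⟨h.1, h.2⟩⟩
    rw [heq]
    refine (isClosed_iInter fun e => ?_).inter
      (isClosed_iInter fun e' => isClosed_iInter fun e => isClosed_iInter fun g => ?_)
    · exact (isClosed_discrete {x : E | π.obj x = π.obj e}).preimage (hcont e)
    · exact (isClosed_discrete {p : E × E | ∃ g' : p.1 ⟶ p.2, π.map g' ≍ π.map g}).preimage
        ((hcont e').prodMk (hcont e))
  have hcompact : IsCompact {a : Function.End E | IsEndo π a} := by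
    have hpi : IsCompact {a : E → E | ∀ e, a e ∈ {x | π.obj x = π.obj e}} :=
      isCompact_pi_infinite fun e => (hpre (π.obj e)).isCompact
    exact hpi.of_isClosed_subset hclosed fun a ha => ha.obj
  have : CompactSpace (submonoid π) := isCompact_iff_compactSpace.mp hcompact
  obtain ⟨⟨a, ha⟩, haa, hmin⟩ := exists_idempotent_mem_minimal_leftIdeal (M := submonoid π)
    fun r => Continuous.subtype_mk
      (continuous_pi (A := fun _ => E) fun e => (hcont (r.1 e)).comp continuous_subtype_val) _
  refine ⟨a, ha, congrArg Subtype.val haa, fun x hx => ?_⟩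
  obtain ⟨⟨y, hy⟩, hyx⟩ := hmin ⟨x, hx⟩
  exact ⟨y, hy, congrArg Subtype.val hyx⟩

end IsEndo

/-- The elements of a corner of a monoid of self-maps all have inverses in the corner, provided
its idempotent generates a minimal left ideal. -/
theorem exists_corner_inverse {E : Type*} {P : (E → E) → Prop} {a : E → E}
    (hP : ∀ x y, P x → P y → P (x ∘ y)) (ha : P a) (haa : a ∘ a = a)
    (hmin : ∀ x, P x → ∃ y, P y ∧ y ∘ x ∘ a = a)
    {x : E → E} (hx : P x) (hax : a ∘ x = x) (hxa : x ∘ a = x) :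
    ∃ y, a ∘ y = y ∧ y ∘ x = a ∧ x ∘ y = a := by
  have left_inverse (x : E → E) (hx : P x) (hax : a ∘ x = x) (hxa : x ∘ a = x) :
      ∃ y, P y ∧ a ∘ y = y ∧ y ∘ a = y ∧ y ∘ x = a := by
    obtain ⟨y, hy, hyx⟩ := hmin x hx
    refine ⟨a ∘ y ∘ a, hP _ _ ha (hP _ _ hy ha), ?_, ?_, ?_⟩
    · rw [← Function.comp_assoc, haa]
    · rw [Function.comp_assoc, Function.comp_assoc, haa]
    · rw [Function.comp_assoc, Function.comp_assoc, hax, ← hxa, hyx, haa]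
  obtain ⟨y, hy, hay, hya, hyx⟩ := left_inverse x hx hax hxa
  obtain ⟨z, -, -, hza, hzy⟩ := left_inverse y hy hay hya
  have hzx : z = x := by rw [← hza, ← hyx, ← Function.comp_assoc, hzy, hax]
  exact ⟨y, hay, hyx, hzx ▸ hzy⟩

theorem ramsey_expansion_has_core
    (C E : Type) [SmallCategory C] [SmallCategory E]
    (π : E ⥤ C) (hπ : IsExpansion π) (hpre : Precompact π)
    (hlf : ∀ A B : E, Finite (A ⟶ B))
    (hconf : Confluent E) (hram : RamseyProp E) :
    ∃ (F : Type) (_ : SmallCategory F) (ρ : F ⥤ C),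
      IsExpansion ρ ∧ IsCore ρ ∧
        (∃ α : F ⥤ E, α ⋙ π = ρ) ∧ (∃ β : E ⥤ F, β ⋙ ρ = π) := by
  obtain ⟨a, ha, haa, hmin⟩ := IsEndo.exists_minimal_idempotent hpre
  let : SmallCategory {e : E // a e = e} := IsEndo.fixedCategory a
  let ι : {e : E // a e = e} ⥤ E := { obj := Subtype.val, map := fun f => f }
  choose m hm using ha.map
  let β : E ⥤ {e : E // a e = e} :=
    { obj := fun e => ⟨a e, congrFun haa e⟩
      map := fun {x y} g => m x y g
      map_id := fun x => hπ.map_injective ((hm _ _ _).trans (ha.map_id_heq x).symm)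
      map_comp := fun f g =>
        hπ.map_injective ((hm _ _ _).trans (ha.map_comp_heq (hm _ _ f) (hm _ _ g)).symm) }
  have hβ : β ⋙ ι ⋙ π = π := CategoryTheory.Functor.hext ha.obj hm
  refine ⟨{e : E // a e = e}, inferInstance, ι ⋙ π, ⟨fun c => ?_, fun e c f => ?_⟩,
    fun γ hγ => ?_, ⟨ι, rfl⟩, ⟨β, hβ⟩⟩
  · obtain ⟨e, rfl⟩ := hπ.surj c
    exact ⟨β.obj e, ha.obj e⟩
  · obtain ⟨e', g, rfl, hg⟩ := hπ.exists_lift f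
    obtain ⟨e, he⟩ := e
    have hfix : a e' = e' := by
      obtain ⟨g', hg'⟩ := ha.map _ _ g
      have := hπ.lift_unique (g' ≫ eqToHom he) g (ha.obj e') (by
        rw [Functor.map_comp, eqToHom_map]
        exact (comp_eqToHom_heq _ _).trans hg')
      exact congrArg Sigma.fst this
    refine ⟨⟨⟨e', hfix⟩, g⟩, ⟨rfl, by simpa using eq_of_heq hg⟩, ?_⟩
    rintro ⟨⟨e'', hfix'⟩, k⟩ ⟨h, hk⟩
    have hk' : π.map k ≍ f := (heq_of_eq hk).trans (eqToHom_comp_heq _ _)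
    have := hπ.lift_unique (e := e) k g h (hk'.trans hg.symm)
    obtain ⟨rfl, hkg⟩ := Sigma.mk.inj_iff.mp this
    obtain rfl := eq_of_heq hkg
    rfl
  · have hx : IsEndo π (β ⋙ γ ⋙ ι).obj := IsEndo.of_functor _ (by
      change β ⋙ γ ⋙ ι ⋙ π = π
      rw [hγ, hβ])
    have hβι (p : {e : E // a e = e}) : β.obj p.1 = p := Subtype.ext p.2
    obtain ⟨y, hay, hyx, hxy⟩ := exists_corner_inverse (fun _ _ => IsEndo.comp) ha haa hmin hx
      (funext fun e => (γ.obj (β.obj e)).2)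
      (funext fun e => congrArg (fun p => (γ.obj p).1) (hβι (β.obj e)))
    have hxγ (p : {e : E // a e = e}) : (β ⋙ γ ⋙ ι).obj p.1 = (γ.obj p).1 :=
      congrArg (fun p => (γ.obj p).1) (hβι p)
    constructor
    · intro p q hpq
      have hpq' : (β ⋙ γ ⋙ ι).obj p.1 = (β ⋙ γ ⋙ ι).obj q.1 := by rw [hxγ, hxγ, hpq]
      have hyp := congrFun hyx p.1
      have hyq := congrFun hyx q.1
      rw [Function.comp_apply] at hyp hyq
      exact Subtype.ext (by rw [← p.2, ← q.2, ← hyp, ← hyq, hpq'])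
    · intro p
      refine ⟨⟨y p.1, congrFun hay p.1⟩, Subtype.ext ?_⟩
      rw [← hxγ]
      exact (congrFun hxy p.1).trans p.2
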